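/- For subdiagrams B' ⊆ B of a diagram D, the map ι sending a chain B' = B₀ ⊊ B₁ ⊊ ⋯ ⊊ B_m = B to the collection of all connected components of all of the B_k is a well-defined surjection from the set of chains from B' to B onto Ns(B,B'), and its restriction to maximal chains is a surjection onto the set of maximal nested sets on B relative to B'. -/

import Mathlib

/-- Two subdiagrams of a diagram `G` are *orthogonal* if they are disjoint and no edge of
`G` joins a vertex of one to a vertex of the other. -/
def Diagram.Orthogonal {V : Type*} (G : SimpleGraph V) (B₁ B₂ : Finset V) : Prop :=
  Disjoint B₁ B₂ ∧ ∀ i ∈ B₁, ∀ j ∈ B₂, ¬ G.Adj i j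

/-- Two subdiagrams are *compatible* if one contains the other or they are orthogonal. -/
def Diagram.Compatible {V : Type*} (G : SimpleGraph V) (B₁ B₂ : Finset V) : Prop :=
  B₁ ⊆ B₂ ∨ B₂ ⊆ B₁ ∨ Diagram.Orthogonal G B₁ B₂

/-- A subdiagram is *connected* if the induced subgraph is connected. -/
def Diagram.IsConnSub {V : Type*} (G : SimpleGraph V) (C : Finset V) : Prop :=
  (G.induce (C : Set V)).Connected

/-- `C` is a connected component of the subdiagram `B`. -/
def Diagram.IsCC {V : Type*} (G : SimpleGraph V) (B C : Finset V) : Prop :=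
  C ⊆ B ∧ Diagram.IsConnSub G C ∧
    ∀ C' : Finset V, C ⊆ C' → C' ⊆ B → Diagram.IsConnSub G C' → C' = C

/-- A *nested set on `B` relative to `B'`* (an element of `Ns(B,B')`): a collection of
pairwise compatible connected subdiagrams of `B` which contains every connected component
of `B` and of `B'`, and each of whose elements is compatible with, and not properly
contained in, any connected component of `B'`. -/
def Diagram.IsRelNested {V : Type*} (G : SimpleGraph V) (B B' : Finset V)
    (H : Finset (Finset V)) : Prop :=
  (∀ C ∈ H, C ⊆ B ∧ Diagram.IsConnSub G C) ∧
  (∀ C₁ ∈ H, ∀ C₂ ∈ H, Diagram.Compatible G C₁ C₂) ∧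
  (∀ C : Finset V, Diagram.IsCC G B C → C ∈ H) ∧
  (∀ C : Finset V, Diagram.IsCC G B' C → C ∈ H) ∧
  (∀ C ∈ H, ∀ C' : Finset V, Diagram.IsCC G B' C' → Diagram.Compatible G C C' ∧ ¬ C ⊂ C')

/-- A *maximal* nested set on `B` relative to `B'`: one maximal with respect to inclusion
among relative nested sets. -/
def Diagram.IsMaxRelNested {V : Type*} (G : SimpleGraph V) (B B' : Finset V)
    (H : Finset (Finset V)) : Prop :=
  Diagram.IsRelNested G B B' H ∧
    ∀ H' : Finset (Finset V), Diagram.IsRelNested G B B' H' → H ⊆ H' → H' = H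

/-- A *chain* from `B'` to `B`: a strictly increasing sequence of subdiagrams
`B' = B₀ ⊊ B₁ ⊊ ⋯ ⊊ B_m = B`, encoded as the list `[B₀, B₁, …, B_m]`. -/
def Diagram.IsChainList {V : Type*} (B' B : Finset V) (l : List (Finset V)) : Prop :=
  l.Chain' (· ⊂ ·) ∧ l.head? = some B' ∧ l.getLast? = some B

/-- A *maximal chain*: a chain whose consecutive terms differ by exactly one vertex. -/
def Diagram.IsMaxChainList {V : Type*} [DecidableEq V] (B' B : Finset V)
    (l : List (Finset V)) : Prop :=
  Diagram.IsChainList B' B l ∧ l.Chain' (fun X Y => (Y \ X).card = 1)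

open Classical in
/-- The finite set of connected components of the subdiagram `B`. -/
noncomputable def Diagram.ccFinset {V : Type*} [Fintype V] [DecidableEq V]
    (G : SimpleGraph V) (B : Finset V) : Finset (Finset V) :=
  Finset.univ.filter (fun C => Diagram.IsCC G B C)

/-- The map `ι` sending a chain to the collection of all connected components of all of
its terms. -/
noncomputable def Diagram.iotaChain {V : Type*} [Fintype V] [DecidableEq V]
    (G : SimpleGraph V) (l : List (Finset V)) : Finset (Finset V) :=
  l.foldr (fun Bk acc => Diagram.ccFinset G Bk ∪ acc) ∅

namespace Diagram

section Components

variable {V : Type*} {G : SimpleGraph V} {A A' B B' C C' D : Finset V}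
  {H : Finset (Finset V)}

theorem Orthogonal.symm (h : Orthogonal G C D) : Orthogonal G D C :=
  ⟨h.1.symm, fun i hi j hj hij => h.2 j hj i hi hij.symm⟩

theorem Compatible.symm (h : Compatible G C D) : Compatible G D C := by
  rcases h with h | h | h
  · exact .inr (.inl h)
  · exact .inl h
  · exact .inr (.inr h.symm)

theorem IsConnSub.nonempty (h : IsConnSub G C) : C.Nonempty := by
  obtain ⟨x⟩ := SimpleGraph.Connected.nonempty h
  exact ⟨x.1, x.2⟩

theorem isConnSub_singleton (x : V) : IsConnSub G {x} := by
  unfold IsConnSub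
  rw [Finset.coe_singleton]
  exact SimpleGraph.Connected.of_subsingleton

theorem IsConnSub.union [DecidableEq V] (hC : IsConnSub G C) (hD : IsConnSub G D)
    (h : ¬ Orthogonal G C D) : IsConnSub G (C ∪ D) := by
  unfold IsConnSub at *
  rw [Finset.coe_union]
  by_cases hd : Disjoint C D
  · have : ∃ a ∈ C, ∃ b ∈ D, G.Adj a b := by
      by_contra! hne
      exact h ⟨hd, hne⟩
    obtain ⟨a, ha, b, hb, hab⟩ := this
    have hCab := SimpleGraph.induce_union_connected hC.preconnected
      (SimpleGraph.induce_pair_connected_of_adj hab).preconnected ⟨a, ha, by simp⟩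
    have hall := SimpleGraph.induce_union_connected hCab.preconnected hD.preconnected
      ⟨b, .inr (by simp), hb⟩
    have heq : (C : Set V) ∪ D = (C : Set V) ∪ {a, b} ∪ D := by
      ext x
      simp only [Set.mem_union, Finset.mem_coe, Set.mem_insert_iff, Set.mem_singleton_iff]
      grind
    rwa [heq]
  · obtain ⟨a, ha, hb⟩ := Finset.not_disjoint_iff.1 hd
    exact SimpleGraph.induce_union_connected hC.preconnected hD.preconnected ⟨a, ha, hb⟩

/-- A nonempty proper subset of a connected subdiagram is joined by an edge to its complement. -/
theorem IsConnSub.exists_adj_of_ssubset (hD : IsConnSub G D) (hC : C.Nonempty) (h : C ⊂ D) :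
    ∃ a ∈ C, ∃ b ∈ D, b ∉ C ∧ G.Adj a b := by
  obtain ⟨x, hx⟩ := hC
  obtain ⟨y, hyD, hyC⟩ := Finset.exists_of_ssubset h
  obtain ⟨p⟩ := SimpleGraph.Connected.preconnected hD ⟨x, h.subset hx⟩ ⟨y, hyD⟩
  obtain ⟨d, -, h₁, h₂⟩ := p.exists_boundary_dart {z | z.1 ∈ C} hx hyC
  exact ⟨d.fst.1, h₁, d.snd.1, d.snd.2, h₂, d.adj⟩

theorem exists_isCC_of_isConnSub [Fintype V] (hC : IsConnSub G C) (h : C ⊆ B) :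
    ∃ D, IsCC G B D ∧ C ⊆ D := by
  classical
  obtain ⟨D, hCD, hD⟩ := Set.Finite.exists_le_maximal
    (Set.toFinite {E : Finset V | E ⊆ B ∧ IsConnSub G E}) ⟨h, hC⟩
  exact ⟨D, ⟨hD.prop.1, hD.prop.2, fun E hDE hEB hE => (hD.eq_of_le ⟨hEB, hE⟩ hDE).symm⟩, hCD⟩

theorem exists_isCC_of_mem [Fintype V] {x : V} (hx : x ∈ B) : ∃ D, IsCC G B D ∧ x ∈ D := by
  obtain ⟨D, hD, h⟩ := exists_isCC_of_isConnSub (G := G) (isConnSub_singleton x)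
    (Finset.singleton_subset_iff.2 hx)
  exact ⟨D, hD, h (Finset.mem_singleton_self x)⟩

theorem IsCC.subset_or_orthogonal (hD : IsCC G B D) (hC : IsConnSub G C) (h : C ⊆ B) :
    C ⊆ D ∨ Orthogonal G C D := by
  classical
  by_contra! hne
  have := hD.2.2 (C ∪ D) Finset.subset_union_right (Finset.union_subset h hD.1)
    (hC.union hD.2.1 hne.2)
  exact hne.1 (this ▸ Finset.subset_union_left)

theorem IsCC.compatible_of_subset (hA : A ⊆ A') (hC : IsCC G A C) (hC' : IsCC G A' C') :
    Compatible G C C' :=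
  (hC'.subset_or_orthogonal hC.2.1 (hC.1.trans hA)).imp_right .inr

theorem IsCC.not_ssubset (hA : A ⊆ A') (hC : IsCC G A C) (hC' : IsCC G A' C') : ¬ C' ⊂ C :=
  fun h => h.ne (hC'.2.2 C h.subset (hC.1.trans hA) hC.2.1).symm

theorem subset_of_forall_isCC_subset [Fintype V] (h : ∀ C, IsCC G B C → C ⊆ A) : B ⊆ A := by
  intro x hx
  obtain ⟨D, hD, hxD⟩ := exists_isCC_of_mem (G := G) hx
  exact h D hD hxD

/-- The components of the union of a pairwise compatible collection of connected subdiagrams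
belong to the collection. -/
theorem mem_of_isCC_biUnion [DecidableEq V] {K : Finset (Finset V)}
    (hconn : ∀ C ∈ K, IsConnSub G C) (hcomp : ∀ C ∈ K, ∀ D ∈ K, Compatible G C D)
    (hC : IsCC G (K.biUnion id) C) : C ∈ K := by
  obtain ⟨x, hx⟩ := hC.2.1.nonempty
  obtain ⟨E₀, hE₀, hxE₀⟩ := Finset.mem_biUnion.1 (hC.1 hx)
  obtain ⟨E, hE₀E, hE⟩ := K.exists_le_maximal hE₀
  have hsub : ∀ F ∈ K, F ⊆ K.biUnion id := fun F hF => Finset.subset_biUnion_of_mem id hF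
  have hEC : E ⊆ C := by
    refine (hC.subset_or_orthogonal (hconn E hE.prop) (hsub E hE.prop)).resolve_right fun h => ?_
    exact Finset.disjoint_left.1 h.1 (hE₀E hxE₀) hx
  rcases hEC.eq_or_ssubset with h | h
  · exact h ▸ hE.prop
  · obtain ⟨a, ha, b, hb, hbE, hab⟩ :=
      hC.2.1.exists_adj_of_ssubset (hconn E hE.prop).nonempty h
    obtain ⟨F, hF, hbF⟩ := Finset.mem_biUnion.1 (hC.1 hb)
    rcases hcomp E hE.prop F hF with h' | h' | h'
    · exact absurd (hE.le_of_ge hF h' hbF) hbE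
    · exact absurd (h' hbF) hbE
    · exact absurd hab (h'.2 a ha b hbF)

/-- An element of a relative nested set contained in `B'` is a component of `B'`. -/
theorem IsRelNested.isCC_of_subset [Fintype V] (h : IsRelNested G B B' H) (hC : C ∈ H) (hCB : C ⊆ B') :
    IsCC G B' C := by
  obtain ⟨D, hD, hCD⟩ := exists_isCC_of_isConnSub (h.1 C hC).2 hCB
  rcases hCD.eq_or_ssubset with rfl | hss
  · exact hD
  · exact absurd hss (h.2.2.2.2 C hC D hD).2

/-- Removing from a relative nested set on `B` a component of `B` that is not a component of
`B'` leaves a relative nested set on the union of the remaining elements. -/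
theorem IsRelNested.erase [DecidableEq V] {M : Finset V} (h : IsRelNested G B B' H) (hM : ¬ IsCC G B' M) :
    IsRelNested G ((H.erase M).biUnion id) B' (H.erase M) := by
  have hmem : ∀ C ∈ H.erase M, C ∈ H := fun C => Finset.mem_of_mem_erase
  refine ⟨fun C hC => ⟨Finset.subset_biUnion_of_mem id hC, (h.1 C (hmem C hC)).2⟩,
    fun C hC D hD => h.2.1 C (hmem C hC) D (hmem D hD), ?_, ?_,
    fun C hC => h.2.2.2.2 C (hmem C hC)⟩
  · exact fun C hC => mem_of_isCC_biUnion (fun C hC => (h.1 C (hmem C hC)).2)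
      (fun C hC D hD => h.2.1 C (hmem C hC) D (hmem D hD)) hC
  · exact fun C hC => Finset.mem_erase.2 ⟨fun hCM => hM (hCM ▸ hC), h.2.2.2.1 C hC⟩

end Components

section Chains

variable {V : Type*} {A B B' C : Finset V} {l : List (Finset V)}

theorem IsChainList.subset_or_subset (h : IsChainList B' B l) {X Y : Finset V}
    (hX : X ∈ l) (hY : Y ∈ l) : X ⊆ Y ∨ Y ⊆ X := by
  have hp : l.Pairwise (fun X Y => X ⊆ Y ∨ Y ⊆ X) :=
    (List.isChain_iff_pairwise.1 h.1).imp fun h => .inl h.subset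
  have : Std.Symm fun X Y : Finset V => X ⊆ Y ∨ Y ⊆ X := ⟨fun _ _ => Or.symm⟩
  exact List.Pairwise.forall_of_forall (R := fun X Y => X ⊆ Y ∨ Y ⊆ X)
    (fun _ _ => Or.inl subset_rfl) hp hX hY

theorem IsChainList.mem_head (h : IsChainList B' B l) : B' ∈ l := List.mem_of_mem_head? h.2.1

theorem IsChainList.mem_last (h : IsChainList B' B l) : B ∈ l :=
  List.mem_of_getLast? h.2.2

theorem isChainList_singleton (B : Finset V) : IsChainList B B [B] :=
  ⟨List.isChain_singleton _, rfl, rfl⟩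

theorem IsChainList.concat (h : IsChainList B' A l) (hAB : A ⊂ B) :
    IsChainList B' B (l ++ [B]) := by
  refine ⟨List.isChain_append.2 ⟨h.1, List.isChain_singleton _, ?_⟩, ?_, by simp⟩
  · simp [h.2.2, hAB]
  · simp [h.2.1]

theorem IsChainList.cons (h : IsChainList B' B l) (hA : A ⊂ B') : IsChainList A B (A :: l) := by
  refine ⟨List.isChain_cons.2 ⟨by simp [h.2.1, hA], h.1⟩, rfl, ?_⟩
  rw [List.getLast?_cons, h.2.2]; rfl

theorem IsChainList.eq_singleton_or_cons (h : IsChainList B' B l) :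
    (l = [B'] ∧ B' = B) ∨ ∃ A t, l = B' :: t ∧ B' ⊂ A ∧ IsChainList A B t := by
  obtain ⟨hc, hh, hl⟩ := h
  match l, hc, hh, hl with
  | [X], hc, hh, hl => simp_all
  | X :: Y :: t, hc, hh, hl =>
    obtain rfl : X = B' := by simpa using hh
    obtain ⟨hXY, hc⟩ := List.isChain_cons_cons.1 hc
    exact .inr ⟨Y, Y :: t, rfl, hXY, hc, rfl, by simpa using hl⟩

theorem IsChainList.head_subset_of_mem (h : IsChainList B' B l) {X : Finset V} (hX : X ∈ l) :
    B' ⊆ X := by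
  rcases h.eq_singleton_or_cons with ⟨rfl, -⟩ | ⟨A, t, rfl, -, -⟩
  · simp_all
  · rcases List.mem_cons.1 hX with rfl | hX
    · exact subset_rfl
    · exact ((List.pairwise_cons.1 (List.isChain_iff_pairwise.1 h.1)).1 X hX).subset

theorem IsChainList.subset_last_of_mem (h : IsChainList B' B l) {X : Finset V} (hX : X ∈ l) :
    X ⊆ B := by
  induction l generalizing B' with
  | nil => simp at hX
  | cons Y t ih =>
    rcases List.mem_cons.1 hX with rfl | hX'
    · obtain rfl : X = B' := by simpa using h.2.1
      exact h.head_subset_of_mem h.mem_last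
    · rcases h.eq_singleton_or_cons with ⟨h', -⟩ | ⟨A, t', h', -, ht⟩
      · simp_all
      · obtain ⟨rfl, rfl⟩ := List.cons_eq_cons.1 h'
        exact ih ht hX'

variable [DecidableEq V]

/-- A maximal chain can be extended downwards to a maximal chain. -/
theorem IsMaxChainList.exists_extend (h : IsMaxChainList B' B l) (hA : A ⊆ B') :
    ∃ m, IsMaxChainList A B m ∧ l ⊆ m := by
  induction hn : (B' \ A).card generalizing A with
  | zero =>
    obtain rfl : A = B' := hA.antisymm (by simpa using hn)
    exact ⟨l, h, List.Subset.refl l⟩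
  | succ n ih =>
    obtain ⟨v, hv⟩ : (B' \ A).Nonempty := Finset.card_pos.1 (by omega)
    obtain ⟨hvB, hvA⟩ := Finset.mem_sdiff.1 hv
    obtain ⟨m, hm, hlm⟩ := ih (A := insert v A) (Finset.insert_subset hvB hA) (by
      rw [Finset.sdiff_insert, Finset.card_erase_of_mem hv, hn, Nat.add_sub_cancel])
    refine ⟨A :: m, ⟨hm.1.cons (Finset.ssubset_insert hvA), ?_⟩, fun X hX => .tail _ (hlm hX)⟩
    refine List.isChain_cons.2 ⟨?_, hm.2⟩
    simp [hm.1.2.1, hvA]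

/-- Every chain can be refined to a maximal chain. -/
theorem IsChainList.exists_refine (h : IsChainList B' B l) :
    ∃ m, IsMaxChainList B' B m ∧ l ⊆ m := by
  induction l generalizing B' with
  | nil => simpa using h.2.1
  | cons X t ih =>
    rcases h.eq_singleton_or_cons with ⟨h', rfl⟩ | ⟨A, t', h', hA, ht⟩
    · exact ⟨[B'], ⟨isChainList_singleton B', List.isChain_singleton _⟩, h' ▸ List.Subset.refl _⟩
    · obtain ⟨rfl, rfl⟩ := List.cons_eq_cons.1 h'
      obtain ⟨m, hm, htm⟩ := ih ht
      obtain ⟨m', hm', hmm'⟩ := hm.exists_extend hA.subset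
      exact ⟨m', hm', List.cons_subset.2 ⟨hm'.1.mem_head, List.Subset.trans htm hmm'⟩⟩

/-- In a maximal chain, a subset of the last term that is not contained in the first term
appears at some step which adds a single vertex. -/
theorem IsMaxChainList.exists_step (h : IsMaxChainList B' B l) (hC : C ⊆ B) (hC' : ¬ C ⊆ B') :
    ∃ X v, X ∈ l ∧ insert v X ∈ l ∧ v ∉ X ∧ C ⊆ insert v X ∧ ¬ C ⊆ X := by
  induction l generalizing B' with
  | nil => simpa using h.1.2.1
  | cons X t ih =>
    rcases h.1.eq_singleton_or_cons with ⟨-, rfl⟩ | ⟨A, t', h', hA, ht⟩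
    · exact absurd hC hC'
    · obtain ⟨rfl, rfl⟩ := List.cons_eq_cons.1 h'
      by_cases hCA : C ⊆ A
      · have hstep : (A \ X).card = 1 := (List.isChain_cons.1 h.2).1 A ht.2.1
        obtain ⟨v, hv⟩ := Finset.card_eq_one.1 hstep
        have hAv : insert v X = A := by
          rw [← Finset.sdiff_union_of_subset hA.subset, hv, Finset.insert_eq]
        refine ⟨X, v, by simp, ?_, ?_, hAv ▸ hCA, hC'⟩
        · exact hAv ▸ .tail _ ht.mem_head
        · exact (Finset.mem_sdiff.1 (hv ▸ Finset.mem_singleton_self v)).2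
      · obtain ⟨Y, v, hY, hvY, h₁, h₂, h₃⟩ := ih ⟨ht, (List.isChain_cons.1 h.2).2⟩ hCA
        exact ⟨Y, v, .tail _ hY, .tail _ hvY, h₁, h₂, h₃⟩

end Chains

section Iota

variable {V : Type*} [Fintype V] [DecidableEq V] {G : SimpleGraph V} {B B' C : Finset V}
  {l m : List (Finset V)} {H : Finset (Finset V)}

theorem mem_ccFinset : C ∈ ccFinset G B ↔ IsCC G B C := by
  simp [ccFinset]

theorem mem_iotaChain : C ∈ iotaChain G l ↔ ∃ X ∈ l, IsCC G X C := by
  induction l with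
  | nil => simp [iotaChain]
  | cons X t ih =>
    rw [show iotaChain G (X :: t) = ccFinset G X ∪ iotaChain G t from rfl, Finset.mem_union,
      mem_ccFinset, ih]
    simp

theorem iotaChain_mono (h : l ⊆ m) : iotaChain G l ⊆ iotaChain G m := by
  intro C hC
  obtain ⟨X, hX, hXC⟩ := mem_iotaChain.1 hC
  exact mem_iotaChain.2 ⟨X, h hX, hXC⟩

theorem IsChainList.isRelNested_iotaChain (h : IsChainList B' B l) :
    IsRelNested G B B' (iotaChain G l) := by
  refine ⟨?_, ?_, ?_, ?_, ?_⟩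
  · intro C hC
    obtain ⟨X, hX, hC⟩ := mem_iotaChain.1 hC
    exact ⟨hC.1.trans (h.subset_last_of_mem hX), hC.2.1⟩
  · intro C₁ h₁ C₂ h₂
    obtain ⟨X, hX, h₁⟩ := mem_iotaChain.1 h₁
    obtain ⟨Y, hY, h₂⟩ := mem_iotaChain.1 h₂
    rcases h.subset_or_subset hX hY with hXY | hXY
    · exact h₁.compatible_of_subset hXY h₂
    · exact (h₂.compatible_of_subset hXY h₁).symm
  · exact fun C hC => mem_iotaChain.2 ⟨B, h.mem_last, hC⟩
  · exact fun C hC => mem_iotaChain.2 ⟨B', h.mem_head, hC⟩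
  · intro C hC C' hC'
    obtain ⟨X, hX, hC⟩ := mem_iotaChain.1 hC
    have hsub := h.head_subset_of_mem hX
    exact ⟨(hC'.compatible_of_subset hsub hC).symm, hC'.not_ssubset hsub hC⟩

theorem IsRelNested.exists_chain (h : IsRelNested G B B' H) :
    ∃ l, IsChainList B' B l ∧ iotaChain G l = H := by
  induction hn : H.card using Nat.strong_induction_on generalizing B H with
  | _ n ih =>
    by_cases hall : ∀ C, IsCC G B C → IsCC G B' C
    · have hBB' : B ⊆ B' := subset_of_forall_isCC_subset fun C hC => (hall C hC).1
      have hB'B : B' ⊆ B :=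
        subset_of_forall_isCC_subset fun C hC => (h.1 C (h.2.2.2.1 C hC)).1
      obtain rfl := hBB'.antisymm hB'B
      refine ⟨[B], isChainList_singleton B, Finset.ext fun C => ?_⟩
      rw [mem_iotaChain]
      simp only [List.mem_singleton, exists_eq_left]
      exact ⟨h.2.2.1 C, fun hC => h.isCC_of_subset hC (h.1 C hC).1⟩
    · push Not at hall
      obtain ⟨M, hMB, hMB'⟩ := hall
      have hM : M ∈ H := h.2.2.1 M hMB
      have hK := h.erase hMB'
      have hss : (H.erase M).biUnion id ⊂ B := by
        refine Finset.ssubset_iff_subset_ne.2 ⟨Finset.biUnion_subset.2 fun C hC =>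
          (h.1 C (Finset.mem_of_mem_erase hC)).1, fun heq => ?_⟩
        exact Finset.notMem_erase M H (hK.2.2.1 M (heq ▸ hMB))
      obtain ⟨l, hl, hlK⟩ := ih _ (hn ▸ Finset.card_erase_lt_of_mem hM) hK rfl
      refine ⟨l ++ [B], hl.concat hss, Finset.ext fun C => ?_⟩
      have hC : C ∈ H.erase M ↔ ∃ X ∈ l, IsCC G X C := by rw [← hlK, mem_iotaChain]
      rw [mem_iotaChain]
      simp only [List.mem_append, List.mem_singleton, or_and_right, exists_or, exists_eq_left,
        ← hC]
      refine ⟨fun h' => h'.elim Finset.mem_of_mem_erase (h.2.2.1 C), fun h' => ?_⟩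
      by_cases hCM : C = M
      · exact .inr (hCM ▸ hMB)
      · exact .inl (Finset.mem_erase.2 ⟨hCM, h'⟩)

theorem IsMaxChainList.isMaxRelNested_iotaChain (h : IsMaxChainList B' B l) :
    IsMaxRelNested G B B' (iotaChain G l) := by
  refine ⟨h.1.isRelNested_iotaChain, fun H hH hsub => Finset.Subset.antisymm ?_ hsub⟩
  intro C hC
  obtain ⟨hCB, hconn⟩ := hH.1 C hC
  by_cases hCB' : C ⊆ B'
  · exact mem_iotaChain.2 ⟨B', h.1.mem_head, hH.isCC_of_subset hC hCB'⟩
  obtain ⟨X, v, hX, hvX, hv, hCX, hnX⟩ := h.exists_step hCB hCB'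
  have hvC : v ∈ C := by
    by_contra hvC
    exact hnX ((Finset.subset_insert_iff_of_notMem hvC).1 hCX)
  obtain ⟨D, hD, hCD⟩ := exists_isCC_of_isConnSub hconn hCX
  rcases hCD.eq_or_ssubset with rfl | hss
  · exact mem_iotaChain.2 ⟨_, hvX, hD⟩
  obtain ⟨a, ha, b, hb, hbC, hab⟩ := hD.2.1.exists_adj_of_ssubset hconn.nonempty hss
  have hbX : b ∈ X := Finset.mem_of_mem_insert_of_ne (hD.1 hb) fun hbv => hbC (hbv ▸ hvC)
  obtain ⟨E, hE, hbE⟩ := exists_isCC_of_mem (G := G) hbX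
  rcases hH.2.1 C hC E (hsub (mem_iotaChain.2 ⟨X, hX, hE⟩)) with h' | h' | h'
  · exact absurd (hE.1 (h' hvC)) hv
  · exact absurd (h' hbE) hbC
  · exact absurd hab (h'.2 a ha b hbE)

theorem IsMaxRelNested.exists_maxChain (h : IsMaxRelNested G B B' H) :
    ∃ l, IsMaxChainList B' B l ∧ iotaChain G l = H := by
  obtain ⟨l, hl, rfl⟩ := h.1.exists_chain
  obtain ⟨m, hm, hlm⟩ := hl.exists_refine
  exact ⟨m, hm, h.2 _ hm.1.isRelNested_iotaChain (iotaChain_mono hlm)⟩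

end Iota

end Diagram

/-- For subdiagrams `B' ⊆ B` of a diagram `D`, the map `ι` sending a chain
`B' = B₀ ⊊ B₁ ⊊ ⋯ ⊊ B_m = B` to the collection of all connected components of all of the
`B_k` is a well-defined surjection from the set of chains from `B'` to `B` onto
`Ns(B,B')`, and its restriction to maximal chains is a surjection onto the set of maximal
nested sets on `B` relative to `B'`. -/
theorem iotaChain_surjOn {V : Type*} [Fintype V] [DecidableEq V] (G : SimpleGraph V)
    (B B' : Finset V) (hsub : B' ⊆ B) :
    (∀ l : List (Finset V), Diagram.IsChainList B' B l →
        Diagram.IsRelNested G B B' (Diagram.iotaChain G l)) ∧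
    (∀ H : Finset (Finset V), Diagram.IsRelNested G B B' H →
        ∃ l : List (Finset V), Diagram.IsChainList B' B l ∧ Diagram.iotaChain G l = H) ∧
    (∀ l : List (Finset V), Diagram.IsMaxChainList B' B l →
        Diagram.IsMaxRelNested G B B' (Diagram.iotaChain G l)) ∧
    (∀ H : Finset (Finset V), Diagram.IsMaxRelNested G B B' H →
        ∃ l : List (Finset V), Diagram.IsMaxChainList B' B l ∧
          Diagram.iotaChain G l = H) := by
  exact ⟨fun _ hl => hl.isRelNested_iotaChain, fun _ hH => hH.exists_chain,
    fun _ hl => hl.isMaxRelNested_iotaChain, fun _ hH => hH.exists_maxChain⟩
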